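/- For every t with 2 ≤ t ≤ m−1, an isometry g of F^n satisfies g(B^t) = B^t if and only if for every r ∈ V^t there exists r' ∈ V^t with g(r + Ω(A^{t−1})) = r' + Ω(A^{t−1}); that is, Aut(B^t) = Aut({r + Ω(A^{t−1})}_{r∈V^t}). -/

import Mathlib

open Finset Pointwise

abbrev Word (n : ℕ) := Fin n → ZMod 2

def FEv (n : ℕ) : Set (Word n) := {x | Even (hammingNorm x)}

def FOd (n : ℕ) : Set (Word n) := {x | ¬ Even (hammingNorm x)}

def nbr {n : ℕ} (S : Set (Word n)) : Set (Word n) := {y | ∃ x ∈ S, hammingDist y x = 1}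

def theta {n : ℕ} (G : Set (Word n)) : Set (Word n) :=
  {x | Even (hammingNorm x) ∧ nbr {x} ⊆ nbr G}

def ExtPerfect {n : ℕ} (C : Set (Word n)) : Prop :=
  C ⊆ FEv n ∧ (∀ x ∈ C, ∀ y ∈ C, x ≠ y → Disjoint (nbr {x}) (nbr {y})) ∧ nbr C = FOd n

def IsIsometry {n : ℕ} (g : Word n → Word n) : Prop :=
  Function.Bijective g ∧ ∀ x y, hammingDist (g x) (g y) = hammingDist x y

def embWord (m t : ℕ) (v : Word (2 ^ (m - t))) : Word (2 ^ m) := fun i =>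
  if h : (i : ℕ) < 2 ^ (m - t) then v ⟨i, h⟩
  else if h2 : (i : ℕ) < 2 * 2 ^ (m - t) then v ⟨(i : ℕ) - 2 ^ (m - t), by omega⟩
  else 0

def Vt (m t : ℕ) : Set (Word (2 ^ m)) :=
  {x | ∃ v : Word (2 ^ (m - t)), Even (hammingNorm v) ∧ x = embWord m t v}

def At (m : ℕ) : ℕ → Set (Word (2 ^ m))
  | 0 => {0}
  | 1 => Vt m 1
  | t + 2 => Vt m (t + 2) + At m (t + 1)

def IsComp (m t : ℕ) (G : Set (Word (2 ^ m))) : Prop :=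
  G ⊆ FEv (2 ^ m) ∧ G.ncard = (At m t).ncard ∧ nbr G = nbr (At m t)

def IsMuComp (m t : ℕ) (μ : Word (2 ^ m)) (M : Set (Word (2 ^ m))) : Prop :=
  (∀ i : Fin (2 ^ m), 2 ^ (m - t) ≤ (i : ℕ) → μ i = 0) ∧
  ∃ G, IsComp m t G ∧ M = (fun x => μ + x) '' G

def arrEntry (m t : ℕ) (x : Word (2 ^ m)) (i : Fin (2 ^ t)) (j : Fin (2 ^ (m - t))) : ZMod 2 :=
  x ⟨((i : ℕ) * 2 ^ (m - t) + (j : ℕ)) % 2 ^ m, Nat.mod_lt _ (Nat.two_pow_pos m)⟩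

def pchk (m t : ℕ) (x : Word (2 ^ m)) : Word (2 ^ (m - t)) :=
  fun j => ∑ i : Fin (2 ^ t), arrEntry m t x i j

def Bt (m : ℕ) : ℕ → Set (Word (2 ^ m))
  | 0 => Vt m 1
  | 1 => Vt m 1
  | t + 2 => Vt m (t + 2) + theta (At m (t + 1))

theorem word_add_self {n : ℕ} (x : Word n) : x + x = 0 :=
  funext fun i => CharTwo.add_self_eq_zero (x i)

theorem word_add_add_self {n : ℕ} (x y : Word n) : x + (x + y) = y := by
  rw [← add_assoc, word_add_self, zero_add]

theorem hammingNorm_cast {n : ℕ} (v : Word n) : (hammingNorm v : ZMod 2) = ∑ i, v i := by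
  rw [hammingNorm, Finset.card_filter]
  push_cast
  refine Finset.sum_congr rfl fun i _ => ?_
  generalize v i = a
  revert a
  decide

theorem even_hammingNorm_iff {n : ℕ} (v : Word n) : Even (hammingNorm v) ↔ ∑ i, v i = 0 := by
  rw [← hammingNorm_cast, ZMod.natCast_eq_zero_iff_even]

theorem hammingDist_eq_one_iff {n : ℕ} (x y : Word n) :
    hammingDist y x = 1 ↔ ∃ p, y = x + Pi.single p 1 := by
  constructor
  · intro h
    obtain ⟨p, hp⟩ := Finset.card_eq_one.mp h
    refine ⟨p, funext fun i => ?_⟩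
    have hi := Finset.ext_iff.mp hp i
    simp only [Finset.mem_filter, Finset.mem_univ, true_and, Finset.mem_singleton] at hi
    by_cases hip : i = p
    · subst hip
      simp only [iff_true] at hi
      simp only [Pi.add_apply, Pi.single_eq_same]
      generalize x i = a at *
      generalize y i = b at *
      revert a b
      decide
    · simp only [hip, iff_false, not_not] at hi
      simp [hip, hi]
  · rintro ⟨p, rfl⟩
    refine Finset.card_eq_one.mpr ⟨p, Finset.ext fun i => ?_⟩
    by_cases hip : i = p
    · subst hip; simp
    · simp [hip]

theorem hammingDist_add_pair_le {n : ℕ} (x : Word n) (p q : Fin n) :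
    hammingDist (x + Pi.single p 1 + Pi.single q 1) x ≤ 2 := by
  have h1 := (hammingDist_eq_one_iff x (x + Pi.single p 1)).mpr ⟨p, rfl⟩
  have h2 := (hammingDist_eq_one_iff (x + Pi.single p 1)
    (x + Pi.single p 1 + Pi.single q 1)).mpr ⟨q, rfl⟩
  have h3 := hammingDist_triangle (x + Pi.single p 1 + Pi.single q 1) (x + Pi.single p 1) x
  omega

/-- The sums of the coordinates of a word over the residue classes of positions modulo `s`. -/
def colSum (n s : ℕ) : Word n →+ Word s where
  toFun x j := ∑ p : Fin n, if (p : ℕ) % s = j then x p else 0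
  map_zero' := by funext j; simp
  map_add' x y := by
    funext j
    simp only [Pi.add_apply, ← Finset.sum_add_distrib]
    refine Finset.sum_congr rfl fun p _ => ?_
    split_ifs <;> simp

theorem colSum_apply {n s : ℕ} (x : Word n) (j : Fin s) :
    colSum n s x j = ∑ p : Fin n, if (p : ℕ) % s = j then x p else 0 := rfl

theorem colSum_single {n s : ℕ} (hs : 0 < s) (p : Fin n) (a : ZMod 2) :
    colSum n s (Pi.single p a) = Pi.single ⟨p % s, Nat.mod_lt _ hs⟩ a := by
  funext j
  rw [colSum_apply, Finset.sum_eq_single p]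
  · simp [Pi.single_apply, Fin.ext_iff, eq_comm]
  · intro q _ hq
    simp [hq]
  · simp

theorem exists_colSum_single {n s : ℕ} (hs : s ≤ n) (j : Fin s) :
    ∃ p : Fin n, ∀ a, colSum n s (Pi.single p a) = Pi.single j a := by
  refine ⟨⟨j, by omega⟩, fun a => ?_⟩
  rw [colSum_single j.pos]
  congr 1
  exact Fin.ext (Nat.mod_eq_of_lt j.2)

theorem colSum_of_support {n s : ℕ} (hs : s ≤ n) (x : Word n)
    (hx : ∀ p : Fin n, s ≤ (p : ℕ) → x p = 0) (j : Fin s) :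
    colSum n s x j = x ⟨j, by omega⟩ := by
  rw [colSum_apply, Finset.sum_eq_single ⟨j, by omega⟩]
  · simp [Nat.mod_eq_of_lt j.2]
  · intro q _ hq
    rcases lt_or_ge (q : ℕ) s with h | h
    · rw [Nat.mod_eq_of_lt h, if_neg]
      exact fun hqj => hq (Fin.ext hqj)
    · simp [hx q h]
  · simp

theorem sum_colSum {n s : ℕ} (hs : 0 < s) (x : Word n) : ∑ j, colSum n s x j = ∑ p, x p := by
  simp only [colSum_apply]
  rw [Finset.sum_comm]
  refine Finset.sum_congr rfl fun p _ => ?_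
  rw [Finset.sum_eq_single (⟨p % s, Nat.mod_lt _ hs⟩ : Fin s)]
  · simp
  · intro j _ hj
    rw [if_neg]
    exact fun h => hj (Fin.ext h.symm)
  · simp

theorem colSum_fold {n k : ℕ} (x : Word n) (j : Fin k) :
    colSum n k x j = colSum n (2 * k) x ⟨j, by omega⟩ + colSum n (2 * k) x ⟨j + k, by omega⟩ := by
  simp only [colSum_apply, ← Finset.sum_add_distrib]
  refine Finset.sum_congr rfl fun p _ => ?_
  have hj := j.2
  have hlt : (p : ℕ) % (2 * k) < 2 * k := Nat.mod_lt _ (by omega)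
  have hmod : (p : ℕ) % k = (p : ℕ) % (2 * k) % k := (Nat.mod_mul_left_mod _ _ _).symm
  rw [hmod]
  generalize (p : ℕ) % (2 * k) = q at *
  rcases lt_or_ge q k with h | h
  · rw [Nat.mod_eq_of_lt h, if_neg (c := q = j + k) (by omega), add_zero]
  · rw [Nat.mod_eq_sub_mod h, Nat.mod_eq_of_lt (by omega), if_neg (c := q = j) (by omega), zero_add]
    congr 1
    exact propext (by omega)

/-- A word of zero column sums is a sum of words of weight at most two with zero column sums. -/
theorem eq_sum_pairs {n s : ℕ} (hs : 0 < s) (hsn : s ≤ n) (x : Word n)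
    (hx : colSum n s x = 0) :
    x = ∑ p : Fin n, (Pi.single p (x p) +
      Pi.single ⟨p % s, (Nat.mod_lt _ hs).trans_le hsn⟩ (x p)) := by
  rw [Finset.sum_add_distrib, Finset.univ_sum_single, left_eq_add]
  funext i
  rw [Finset.sum_apply]
  rcases lt_or_ge (i : ℕ) s with h | h
  · have := congrFun hx ⟨i, h⟩
    rw [colSum_apply] at this
    refine Eq.trans (Finset.sum_congr rfl fun p _ => ?_) this
    simp [Pi.single_apply, Fin.ext_iff, eq_comm]
  · refine Finset.sum_eq_zero fun p _ => ?_
    rw [Pi.single_apply, if_neg]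
    intro he
    have := congrArg Fin.val he
    have := Nat.mod_lt (p : ℕ) hs
    simp at *
    omega

theorem eq_zero_of_forall_add_single {s : ℕ} (hs : 3 ≤ s) (u : Word s)
    (h : ∀ j, ∃ i, u + Pi.single j 1 = Pi.single i 1) : u = 0 := by
  have h1 : ∀ j, u = 0 ∨ u j = 1 := by
    intro j
    obtain ⟨i, hi⟩ := h j
    by_cases hij : i = j
    · subst hij
      exact Or.inl (add_eq_right.mp hi)
    · right
      have := congrFun hi j
      simp only [Pi.add_apply, Pi.single_eq_same, Pi.single_apply, Ne.symm hij, if_false] at this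
      exact CharTwo.add_eq_zero.mp this
  by_contra hu
  obtain ⟨i, hi⟩ := h ⟨0, by omega⟩
  obtain ⟨j, hj0, hji⟩ : ∃ j : Fin s, j ≠ ⟨0, by omega⟩ ∧ j ≠ i := by
    by_cases h1i : i = ⟨1, by omega⟩
    · exact ⟨⟨2, by omega⟩, by simp, by simp [h1i]⟩
    · exact ⟨⟨1, by omega⟩, by simp, Ne.symm h1i⟩
  have := congrFun hi j
  simp [hj0, hji, (h1 j).resolve_left hu] at this

section Isometry

variable {n s : ℕ} {V : Set (Word n)}

/-- Words whose column sums agree with those of an element of `V`. -/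
def fiberUnion (s : ℕ) (V : Set (Word n)) : Set (Word n) :=
  {x | ∃ r ∈ V, colSum n s x = colSum n s r}

/-- Words whose column sums are at distance one from those of `r`. -/
def fiberNbr (s : ℕ) (r : Word n) : Set (Word n) :=
  {z | ∃ j, colSum n s z = colSum n s r + Pi.single j 1}

/-- Distinct column sums of elements of `V` are at distance at least three. -/
def ColSeparated (s : ℕ) (V : Set (Word n)) : Prop :=
  ∀ r ∈ V, ∀ r' ∈ V, hammingDist (colSum n s r) (colSum n s r') ≤ 2 → colSum n s r = colSum n s r'

theorem hammingDist_colSum_le (hs : 0 < s) (x y : Word n) :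
    hammingDist (colSum n s x) (colSum n s y) ≤ hammingDist x y := by
  have hsub : (Finset.univ.filter fun j => colSum n s x j ≠ colSum n s y j) ⊆
      (Finset.univ.filter fun p => x p ≠ y p).image
        fun p : Fin n => (⟨p % s, Nat.mod_lt _ hs⟩ : Fin s) := by
    intro j hj
    simp only [Finset.mem_filter, Finset.mem_univ, true_and, Finset.mem_image] at hj ⊢
    by_contra! hcon
    refine hj ?_
    rw [colSum_apply, colSum_apply]
    refine Finset.sum_congr rfl fun p _ => ?_
    split_ifs with hp
    · by_contra hxy
      exact hcon p hxy (Fin.ext hp)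
    · rfl
  exact (Finset.card_le_card hsub).trans Finset.card_image_le

theorem colSum_image_eq (hs : 0 < s) (hsn : s ≤ n) (hV : ColSeparated s V)
    {g : Word n → Word n} (hg : ∀ x y, hammingDist (g x) (g y) = hammingDist x y)
    (hB : ∀ x ∈ fiberUnion s V, g x ∈ fiberUnion s V) {x y : Word n}
    (hx : x ∈ fiberUnion s V) (hxy : colSum n s y = colSum n s x) :
    colSum n s (g y) = colSum n s (g x) := by
  have hk : colSum n s (x + y) = 0 := by rw [map_add, hxy, word_add_self]
  suffices H : ∀ T : Finset (Fin n),
      colSum n s (x + ∑ p ∈ T, (Pi.single p ((x + y) p) +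
        Pi.single ⟨p % s, (Nat.mod_lt _ hs).trans_le hsn⟩ ((x + y) p))) = colSum n s x ∧
      colSum n s (g (x + ∑ p ∈ T, (Pi.single p ((x + y) p) +
        Pi.single ⟨p % s, (Nat.mod_lt _ hs).trans_le hsn⟩ ((x + y) p)))) = colSum n s (g x) by
    have := (H Finset.univ).2
    rwa [← eq_sum_pairs hs hsn _ hk, word_add_add_self] at this
  intro T
  induction T using Finset.induction_on with
  | empty => simp
  | insert p T hp ih =>
    rw [Finset.sum_insert hp, add_comm (_ + _ : Word n), ← add_assoc x]
    set w := x + ∑ p ∈ T, (Pi.single p ((x + y) p) +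
      Pi.single ⟨p % s, (Nat.mod_lt _ hs).trans_le hsn⟩ ((x + y) p))
    generalize (x + y) p = a
    have hw' : colSum n s (w + (Pi.single p a +
        Pi.single ⟨p % s, (Nat.mod_lt _ hs).trans_le hsn⟩ a)) = colSum n s w := by
      rw [map_add, add_eq_left, map_add, colSum_single hs, colSum_single hs]
      simp [word_add_self]
    refine ⟨hw'.trans ih.1, ?_⟩
    rw [← ih.2]
    have hmem : ∀ u : Word n, colSum n s u = colSum n s x → u ∈ fiberUnion s V := by
      obtain ⟨r, hr, hxr⟩ := hx
      exact fun u hu => ⟨r, hr, hu.trans hxr⟩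
    obtain ⟨r, hr, hwr⟩ := hB w (hmem w ih.1)
    obtain ⟨r', hr', hwr'⟩ := hB _ (hmem _ (hw'.trans ih.1))
    rw [hwr, hwr']
    refine hV r' hr' r hr ?_
    rw [← hwr, ← hwr']
    refine (hammingDist_colSum_le hs _ _).trans ?_
    rw [hg]
    have ha : ∀ b : ZMod 2, b = 0 ∨ b = 1 := by decide
    rcases ha a with rfl | rfl
    · simp
    · rw [← add_assoc]
      exact hammingDist_add_pair_le _ _ _

theorem mem_fiberNbr_iff (hs : 0 < s) (hsn : s ≤ n) (r z : Word n) :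
    z ∈ fiberNbr s r ↔ ∃ x, colSum n s x = colSum n s r ∧ hammingDist z x = 1 := by
  constructor
  · rintro ⟨j, hj⟩
    obtain ⟨p, hp⟩ := exists_colSum_single hsn j
    refine ⟨z + Pi.single p 1, ?_, ?_⟩
    · rw [map_add, hp, hj, add_assoc, word_add_self, add_zero]
    · rw [hammingDist_comm]
      exact (hammingDist_eq_one_iff _ _).mpr ⟨p, rfl⟩
  · rintro ⟨x, hx, hd⟩
    obtain ⟨p, rfl⟩ := (hammingDist_eq_one_iff _ _).mp hd
    exact ⟨_, by rw [map_add, hx, colSum_single hs]⟩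

theorem map_mem_fiberNbr (hs : 0 < s) (hsn : s ≤ n)
    {g : Word n → Word n} (hg : ∀ x y, hammingDist (g x) (g y) = hammingDist x y)
    {r r' : Word n} (h : ∀ x, colSum n s x = colSum n s r → colSum n s (g x) = colSum n s r')
    {z : Word n} (hz : z ∈ fiberNbr s r) : g z ∈ fiberNbr s r' := by
  rw [mem_fiberNbr_iff hs hsn] at hz ⊢
  obtain ⟨x, hx, hd⟩ := hz
  exact ⟨g x, h x hx, by rw [hg, hd]⟩

theorem colSum_eq_of_nbr (hs : 3 ≤ s) (hsn : s ≤ n) (r x : Word n)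
    (h : ∀ z, hammingDist z x = 1 → z ∈ fiberNbr s r) : colSum n s x = colSum n s r := by
  have h0 : colSum n s r + colSum n s x = 0 := by
    refine eq_zero_of_forall_add_single hs _ fun j => ?_
    obtain ⟨p, hp⟩ := exists_colSum_single hsn j
    obtain ⟨i, hi⟩ := h (x + Pi.single p 1) ((hammingDist_eq_one_iff _ _).mpr ⟨p, rfl⟩)
    refine ⟨i, ?_⟩
    rw [map_add, hp] at hi
    rw [add_assoc, hi, word_add_add_self]
  have := word_add_add_self (colSum n s r) (colSum n s x)
  rw [h0, add_zero] at this
  exact this.symm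

theorem image_fiberUnion_eq_iff (hs : 3 ≤ s) (hsn : s ≤ n) (hV : ColSeparated s V)
    {g : Word n → Word n} (hg : IsIsometry g) :
    g '' fiberUnion s V = fiberUnion s V ↔
      ∀ r ∈ V, ∃ r' ∈ V, g '' fiberNbr s r = fiberNbr s r' := by
  have hs0 : 0 < s := by omega
  obtain ⟨hbij, hdist⟩ := hg
  obtain ⟨f, hfg, hgf⟩ := Function.bijective_iff_has_inverse.mp hbij
  have hfdist : ∀ x y, hammingDist (f x) (f y) = hammingDist x y := fun x y => by
    rw [← hdist, hgf, hgf]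
  constructor
  · intro hB r hr
    have hgB : ∀ x ∈ fiberUnion s V, g x ∈ fiberUnion s V :=
      fun x hx => hB ▸ Set.mem_image_of_mem g hx
    have hfB : ∀ x ∈ fiberUnion s V, f x ∈ fiberUnion s V := by
      intro x hx
      obtain ⟨y, hy, rfl⟩ := hB.symm ▸ hx
      rwa [hfg]
    have hrB : r ∈ fiberUnion s V := ⟨r, hr, rfl⟩
    obtain ⟨r', hr', hrr'⟩ := hgB r hrB
    refine ⟨r', hr', Set.Subset.antisymm ?_ ?_⟩
    · rintro _ ⟨z, hz, rfl⟩
      exact map_mem_fiberNbr hs0 hsn hdist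
        (fun x hx => (colSum_image_eq hs0 hsn hV hdist hgB hrB hx).trans hrr') hz
    · intro z hz
      refine ⟨f z, map_mem_fiberNbr hs0 hsn hfdist (fun x hx => ?_) hz, hgf z⟩
      have := colSum_image_eq hs0 hsn hV hfdist hfB (hgB r hrB) (hx.trans hrr'.symm)
      rwa [hfg] at this
  · intro h
    refine Set.eq_of_subset_of_ncard_le ?_ (Set.ncard_image_of_injective _ hbij.1).ge
    rintro _ ⟨x, ⟨r, hr, hxr⟩, rfl⟩
    obtain ⟨r', hr', hrr'⟩ := h r hr
    refine ⟨r', hr', colSum_eq_of_nbr hs hsn _ _ fun z hz => ?_⟩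
    rw [← hrr']
    refine ⟨f z, (mem_fiberNbr_iff hs0 hsn _ _).mpr ⟨x, hxr, ?_⟩, hgf z⟩
    rw [← hdist, hgf, hz]

end Isometry

theorem two_pow_sub_succ {m t : ℕ} (ht : t + 1 ≤ m) : 2 ^ (m - t) = 2 * 2 ^ (m - (t + 1)) := by
  rw [← pow_succ', show m - (t + 1) + 1 = m - t by omega]

theorem two_pow_sub_le (m t : ℕ) : 2 ^ (m - t) ≤ 2 ^ m :=
  Nat.pow_le_pow_right (by norm_num) (Nat.sub_le _ _)

theorem colSum_embWord {m t : ℕ} (ht : t + 1 ≤ m) (v : Word (2 ^ (m - (t + 1))))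
    (j : Fin (2 * 2 ^ (m - (t + 1)))) :
    colSum (2 ^ m) (2 * 2 ^ (m - (t + 1))) (embWord m (t + 1) v) j =
      if h : (j : ℕ) < 2 ^ (m - (t + 1)) then v ⟨j, h⟩
      else v ⟨j - 2 ^ (m - (t + 1)), by omega⟩ := by
  have hle : 2 * 2 ^ (m - (t + 1)) ≤ 2 ^ m := two_pow_sub_succ ht ▸ two_pow_sub_le m t
  rw [colSum_of_support hle]
  · simp only [embWord, j.2, dif_pos]
  · intro p hp
    rw [embWord, dif_neg (by omega), dif_neg (by omega)]

theorem At_succ (m t : ℕ) : At m (t + 1) = Vt m (t + 1) + At m t := by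
  cases t with
  | zero => simp [At]
  | succ t => rfl

theorem colSum_Vt {m t : ℕ} (ht : t + 1 ≤ m) {r : Word (2 ^ m)} (hr : r ∈ Vt m (t + 1)) :
    colSum (2 ^ m) (2 ^ (m - (t + 1))) r = 0 := by
  obtain ⟨v, -, rfl⟩ := hr
  funext j
  rw [colSum_fold, colSum_embWord ht, colSum_embWord ht]
  simp [CharTwo.add_self_eq_zero]

theorem colSum_At {m t : ℕ} (ht : t ≤ m) {x : Word (2 ^ m)} (hx : x ∈ At m t) :
    colSum (2 ^ m) (2 ^ (m - t)) x = 0 := by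
  induction t generalizing x with
  | zero =>
    rw [show x = 0 from hx, map_zero]
  | succ t ih =>
    rw [At_succ] at hx
    obtain ⟨r, hr, a, ha, rfl⟩ := hx
    change colSum _ _ (r + a) = 0
    have hfold := ih (by omega) ha
    rw [two_pow_sub_succ ht] at hfold
    rw [map_add, colSum_Vt ht hr, zero_add]
    funext j
    rw [colSum_fold, hfold]
    simp

theorem exists_adjacent_At {m t : ℕ} (ht : t ≤ m) {z : Word (2 ^ m)}
    (hz : ∃ j, colSum (2 ^ m) (2 ^ (m - t)) z = Pi.single j 1) : z ∈ nbr (At m t) := by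
  induction t generalizing z with
  | zero =>
    obtain ⟨j, hj⟩ := hz
    refine ⟨0, rfl, (hammingDist_eq_one_iff _ _).mpr ⟨j, ?_⟩⟩
    rw [zero_add, ← hj]
    exact funext fun i =>
      (colSum_of_support le_rfl z (fun p hp => absurd p.2 (not_lt.mpr hp)) i).symm
  | succ t ih =>
    obtain ⟨j, hj⟩ := hz
    suffices h : ∃ v : Word (2 ^ (m - (t + 1))), Even (hammingNorm v) ∧
        ∃ i, colSum (2 ^ m) (2 ^ (m - t)) (embWord m (t + 1) v + z) = Pi.single i 1 by
      obtain ⟨v, hv, hi⟩ := h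
      obtain ⟨a, ha, hd⟩ := ih (by omega) hi
      refine ⟨embWord m (t + 1) v + a, ?_, ?_⟩
      · rw [At_succ]
        exact Set.add_mem_add ⟨v, hv, rfl⟩ ha
      · obtain ⟨p, hp⟩ := (hammingDist_eq_one_iff _ _).mp hd
        refine (hammingDist_eq_one_iff _ _).mpr ⟨p, ?_⟩
        rw [add_assoc, ← hp, word_add_add_self]
    rw [two_pow_sub_succ ht]
    have hj' := fun i => (colSum_fold z i).symm.trans (congrFun hj i)
    set a : Word (2 ^ (m - (t + 1))) :=
      fun i => colSum (2 ^ m) (2 * 2 ^ (m - (t + 1))) z ⟨i, by omega⟩ with ha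
    have hsplit : ∀ i (h : ¬ (i : ℕ) < 2 ^ (m - (t + 1))) (hi : i < 2 * 2 ^ (m - (t + 1))),
        colSum (2 ^ m) (2 * 2 ^ (m - (t + 1))) z ⟨i, hi⟩ =
          a ⟨i - 2 ^ (m - (t + 1)), by omega⟩ +
            (Pi.single j 1 : Word _) ⟨i - 2 ^ (m - (t + 1)), by omega⟩ := by
      intro i h hi
      rw [← hj']
      simp only [ha, Nat.sub_add_cancel (not_lt.mp h)]
      rw [← add_assoc, CharTwo.add_self_eq_zero, zero_add]
    by_cases hev : Even (hammingNorm a)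
    · refine ⟨a, hev, ⟨j + 2 ^ (m - (t + 1)), by omega⟩, funext fun i => ?_⟩
      rw [map_add, Pi.add_apply, colSum_embWord ht]
      split_ifs with h
      · rw [Pi.single_apply, if_neg (by rw [Fin.ext_iff]; simp; omega)]
        exact CharTwo.add_self_eq_zero _
      · rw [hsplit i h i.2, ← add_assoc, CharTwo.add_self_eq_zero, zero_add]
        simp only [Pi.single_apply, Fin.ext_iff]
        congr 1
        exact propext (by omega)
    · refine ⟨a + Pi.single j 1, ?_, ⟨j, by omega⟩, funext fun i => ?_⟩
      · rw [even_hammingNorm_iff] at hev ⊢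
        simp only [Pi.add_apply, Finset.sum_add_distrib, Finset.sum_pi_single', Finset.mem_univ,
          if_true]
        generalize ∑ i, a i = b at *
        revert b
        decide
      · rw [map_add, Pi.add_apply, colSum_embWord ht]
        split_ifs with h
        · rw [Pi.add_apply, add_right_comm]
          rw [show a ⟨i, h⟩ = colSum (2 ^ m) (2 * 2 ^ (m - (t + 1))) z i from rfl,
            CharTwo.add_self_eq_zero, zero_add]
          simp only [Pi.single_apply, Fin.ext_iff]
        · rw [hsplit i h i.2, Pi.add_apply, CharTwo.add_self_eq_zero, Pi.single_apply, if_neg]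
          rw [Fin.ext_iff]
          simp only
          omega

theorem nbr_At {m t : ℕ} (ht : t ≤ m) : nbr (At m t) = fiberNbr (2 ^ (m - t)) 0 := by
  ext z
  constructor
  · rintro ⟨x, hx, hd⟩
    refine (mem_fiberNbr_iff (by positivity) (two_pow_sub_le m t) _ _).mpr ⟨x, ?_, hd⟩
    rw [colSum_At ht hx, map_zero]
  · rintro ⟨j, hj⟩
    exact exists_adjacent_At ht ⟨j, by rw [hj, map_zero, zero_add]⟩

theorem translate_nbr_At {m t : ℕ} (ht : t ≤ m) (r : Word (2 ^ m)) :
    (fun y => r + y) '' nbr (At m t) = fiberNbr (2 ^ (m - t)) r := by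
  rw [nbr_At ht]
  ext z
  constructor
  · rintro ⟨y, ⟨j, hj⟩, rfl⟩
    exact ⟨j, by rw [map_add, hj, map_zero, zero_add]⟩
  · rintro ⟨j, hj⟩
    exact ⟨r + z, ⟨j, by rw [map_add, hj, map_zero, zero_add, word_add_add_self]⟩,
      word_add_add_self r z⟩

theorem theta_At {m t : ℕ} (ht : t + 2 ≤ m) :
    theta (At m t) = {x | colSum (2 ^ m) (2 ^ (m - t)) x = 0} := by
  have hpos : 0 < 2 ^ (m - t) := by positivity
  have h3 : 3 ≤ 2 ^ (m - t) :=
    le_trans (by norm_num) (Nat.pow_le_pow_right (by norm_num : 0 < 2) (by omega : 2 ≤ m - t))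
  ext x
  rw [theta, nbr_At (by omega)]
  constructor
  · rintro ⟨-, hx⟩
    have := colSum_eq_of_nbr h3 (two_pow_sub_le m t) 0 x fun z hz => hx ⟨x, rfl, hz⟩
    rwa [map_zero] at this
  · intro hx
    refine ⟨?_, ?_⟩
    · rw [even_hammingNorm_iff, ← sum_colSum hpos, show colSum _ _ x = 0 from hx]
      simp
    · rintro z ⟨y, rfl, hd⟩
      exact (mem_fiberNbr_iff hpos (two_pow_sub_le m t) _ _).mpr
        ⟨y, by rw [map_zero]; exact hx, hd⟩

theorem Bt_eq_fiberUnion {m t : ℕ} (ht : t + 2 < m) :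
    Bt m (t + 2) = fiberUnion (2 ^ (m - (t + 1))) (Vt m (t + 2)) := by
  rw [Bt, theta_At (by omega)]
  ext x
  constructor
  · rintro ⟨r, hr, y, hy, rfl⟩
    refine ⟨r, hr, ?_⟩
    change colSum _ _ (r + y) = _
    rw [map_add, show colSum _ _ y = 0 from hy, add_zero]
  · rintro ⟨r, hr, hx⟩
    refine ⟨r, hr, r + x, ?_, word_add_add_self r x⟩
    change colSum _ _ (r + x) = 0
    rw [map_add, hx, word_add_self]

theorem colSeparated_Vt {m t : ℕ} (ht : t + 1 ≤ m) : ColSeparated (2 ^ (m - t)) (Vt m (t + 1)) := by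
  rintro _ ⟨v, hv, rfl⟩ _ ⟨w, hw, rfl⟩ hd
  rw [two_pow_sub_succ ht] at hd ⊢
  have hev : Even (hammingNorm (v + w)) := by
    rw [even_hammingNorm_iff] at *
    simp [Finset.sum_add_distrib, hv, hw]
  suffices h : v = w by rw [h]
  by_contra hne
  have hpos : 0 < hammingNorm (v + w) := by
    rw [hammingNorm_pos_iff]
    intro h0
    apply hne
    rw [← word_add_add_self v w, h0, add_zero]
  have h2 : 1 < (Finset.univ.filter fun i => (v + w) i ≠ 0).card := by
    change 1 < hammingNorm (v + w)
    obtain ⟨c, hc⟩ := hev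
    omega
  obtain ⟨a, ha, b, hb, hab⟩ := Finset.one_lt_card.mp h2
  simp only [Finset.mem_filter, Finset.mem_univ, true_and, Pi.add_apply, ne_eq,
    CharTwo.add_eq_zero] at ha hb
  have hab' : (a : ℕ) ≠ b := fun h => hab (Fin.ext h)
  have h3 : 2 < hammingDist
      (colSum (2 ^ m) (2 * 2 ^ (m - (t + 1))) (embWord m (t + 1) v))
      (colSum (2 ^ m) (2 * 2 ^ (m - (t + 1))) (embWord m (t + 1) w)) := by
    refine Finset.two_lt_card.mpr ⟨⟨a, by omega⟩, ?_, ⟨b, by omega⟩, ?_,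
      ⟨a + 2 ^ (m - (t + 1)), by omega⟩, ?_, ?_, ?_, ?_⟩
    · simp [colSum_embWord ht, ha]
    · simp [colSum_embWord ht, hb]
    · simp [colSum_embWord ht, ha]
    · simpa using hab'
    · simp
    · rw [ne_eq, Fin.ext_iff]
      have := b.2
      simp only
      omega
  omega

/-- for 2 ≤ t ≤ m-1, an isometry g of F^n satisfies g(B^t) = B^t iff
g permutes the collection {r + Ω(A^{t-1})}_{r ∈ V^t}; i.e. Aut(B^t) = Aut({r + Ω(A^{t-1})}_r). -/
theorem stmt_10 (m t : ℕ) (hm : 4 ≤ m) (ht : 2 ≤ t) (ht' : t ≤ m - 1)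
    (g : Word (2 ^ m) → Word (2 ^ m)) (hg : IsIsometry g) :
    g '' Bt m t = Bt m t ↔
      ∀ r ∈ Vt m t, ∃ r' ∈ Vt m t,
        g '' ((fun y => r + y) '' nbr (At m (t - 1)))
          = (fun y => r' + y) '' nbr (At m (t - 1)) := by
  obtain ⟨t, rfl⟩ : ∃ k, t = k + 2 := ⟨t - 2, by omega⟩
  have h3 : 3 ≤ 2 ^ (m - (t + 1)) :=
    le_trans (by norm_num) (Nat.pow_le_pow_right (by norm_num : 0 < 2) (by omega : 2 ≤ m - (t + 1)))
  simp only [show t + 2 - 1 = t + 1 from rfl,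
    translate_nbr_At (show t + 1 ≤ m by omega), Bt_eq_fiberUnion (show t + 2 < m by omega)]
  exact image_fiberUnion_eq_iff h3 (two_pow_sub_le m (t + 1)) (colSeparated_Vt (by omega)) hg
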